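/- arXiv:0804.3623 — 3 statements merged into one kernel-verified Lean document; each statement's English description precedes it below -/
import Mathlib

section
/- Fix α0 < 1, phases θ, t0 ∈ ℝ, and C with 0 ≤ C ≤ sqrt((1−α0)/(5−α0)), and define A, B, ω from α0 and C as in the parameter definitions. Set σ1(t) = (−A + B e^{iω(t−t0)}) e^{−iθ}, σ2(t) = −C e^{iω(t−t0)} e^{−2iθ}, and define p_k : ℝ → ℂ by p_0 ≡ 2, p_1 = σ1, and p_k = σ1 p_{k−1} − σ2 p_{k−2} for k ≥ 2 (so p_k(t) is the sum of the k-th powers of the two roots of z² − σ1(t) z + σ2(t) = 0). Then ω > 0, there exists r < 1 such that |p_k(t)| ≤ 2 r^k for all k ≥ 1 and t ∈ ℝ, and the family c_0(t) = α0, c_k(t) = 2 p_k(t) for k > 0, c_{−k}(t) = conj(c_k(t)), solves Benjamin–Ono in Fourier form and is time-periodic with period 2π/ω: c_k(t + 2π/ω) = c_k(t) for all k ∈ ℤ and t ∈ ℝ. -/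
open Complex

noncomputable section

/-- A family of Fourier coefficients `c k : ℝ → ℂ` solves the spatially `2π`-periodic
Benjamin–Ono equation `u_t = H u_xx - u u_x` in Fourier form. -/
def SolvesBOFourier (c : ℤ → ℝ → ℂ) : Prop :=
  (∀ k : ℤ, Differentiable ℝ (c k)) ∧
  (∀ (k : ℤ) (t : ℝ), c (-k) t = (starRingEnd ℂ) (c k t)) ∧
  (∀ (k : ℤ) (t : ℝ), Summable (fun l : ℤ => ‖c l t * c (k - l) t‖)) ∧
  (∀ (k : ℤ) (t : ℝ), deriv (c k) t =
    Complex.I * (k : ℂ) * ((|k| : ℤ) : ℂ) * c k t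
      - Complex.I * (k : ℂ) / 2 * ∑' l : ℤ, c l t * c (k - l) t)

/-- Newton power sums `p_k = β₁^k + β₂^k` of the two roots of `z² - σ₁ z + σ₂ = 0`,
defined via the recurrence `p_k = σ₁ p_{k-1} - σ₂ p_{k-2}`. -/
def pSeq (σ1 σ2 : ℝ → ℂ) : ℕ → ℝ → ℂ
  | 0 => fun _ => 2
  | 1 => σ1
  | (k+2) => fun t => σ1 t * pSeq σ1 σ2 (k+1) t - σ2 t * pSeq σ1 σ2 k t

/-- The Lucas sequence `g_0 = 0`, `g_1 = 1`, `g_{n+2} = s g_{n+1} - p g_n`. -/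
def lucasSeq (s p : ℂ) : ℕ → ℂ
  | 0 => 0
  | 1 => 1
  | (n+2) => s * lucasSeq s p (n+1) - p * lucasSeq s p n

lemma lucasSeq_add_two (s p : ℂ) (n : ℕ) :
    lucasSeq s p (n+2) = s * lucasSeq s p (n+1) - p * lucasSeq s p n := rfl

lemma lucasSeq_succ_left (z w : ℂ) (n : ℕ) :
    lucasSeq (z + w) (z * w) (n+1) = z ^ n + w * lucasSeq (z + w) (z * w) n := by
  induction n with
  | zero => simp [lucasSeq]
  | succ n ih => rw [lucasSeq_add_two, pow_succ]; linear_combination z * ih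

lemma lucasSeq_eq_geom_sum (z w : ℂ) (n : ℕ) :
    lucasSeq (z + w) (z * w) n = ∑ i ∈ Finset.range n, z ^ i * w ^ (n - 1 - i) := by
  induction n with
  | zero => simp [lucasSeq]
  | succ n ih => rw [lucasSeq_succ_left, ih, Nat.add_sub_cancel, geom_sum₂_succ_eq]

lemma norm_lucasSeq_le {z w : ℂ} {r : ℝ} (hr : r < 1) (hz : ‖z‖ ≤ r) (hw : ‖w‖ ≤ r) (n : ℕ) :
    ‖lucasSeq (z + w) (z * w) n‖ ≤ 1 / (1 - r) := by
  have h1 : 0 < 1 - r := by linarith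
  induction n with
  | zero => simp [lucasSeq, h1.le]
  | succ n ih =>
    rw [lucasSeq_succ_left]
    have hzn : ‖z ^ n‖ ≤ 1 := by
      rw [norm_pow]; exact pow_le_one₀ (norm_nonneg _) (hz.trans hr.le)
    calc ‖z ^ n + w * lucasSeq (z + w) (z * w) n‖
        ≤ ‖z ^ n‖ + ‖w‖ * ‖lucasSeq (z + w) (z * w) n‖ := by
          rw [← norm_mul]; exact norm_add_le _ _
      _ ≤ 1 + r * (1 / (1 - r)) := by
          gcongr
          exact (norm_nonneg _).trans hw
      _ = 1 / (1 - r) := by field_simp; ring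

lemma pSeq_add_two (σ1 σ2 : ℝ → ℂ) (n : ℕ) (t : ℝ) :
    pSeq σ1 σ2 (n+2) t = σ1 t * pSeq σ1 σ2 (n+1) t - σ2 t * pSeq σ1 σ2 n t := rfl

lemma pSeq_eq_lucasSeq (σ1 σ2 : ℝ → ℂ) (n : ℕ) (t : ℝ) :
    pSeq σ1 σ2 n t = 2 * lucasSeq (σ1 t) (σ2 t) (n+1) - σ1 t * lucasSeq (σ1 t) (σ2 t) n := by
  induction n using Nat.twoStepInduction with
  | zero => simp [pSeq, lucasSeq]
  | one => simp [pSeq, lucasSeq]; ring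
  | more n ih1 ih2 =>
    rw [pSeq_add_two, ih1, ih2]
    simp only [lucasSeq_add_two]
    ring

lemma pSeq_eq_pow_add_pow {σ1 σ2 : ℝ → ℂ} {t : ℝ} {z w : ℂ} (h1 : σ1 t = z + w)
    (h2 : σ2 t = z * w) (n : ℕ) : pSeq σ1 σ2 n t = z ^ n + w ^ n := by
  induction n using Nat.twoStepInduction with
  | zero => simp [pSeq]; norm_num
  | one => simp [pSeq, h1]
  | more n ih1 ih2 => rw [pSeq_add_two, ih1, ih2, h1, h2]; ring

lemma pSeq_congr {σ1 σ2 : ℝ → ℂ} {t t' : ℝ} (h1 : σ1 t = σ1 t') (h2 : σ2 t = σ2 t') (n : ℕ) :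
    pSeq σ1 σ2 n t = pSeq σ1 σ2 n t' := by
  rw [pSeq_eq_lucasSeq, pSeq_eq_lucasSeq, h1, h2]

lemma hasDerivAt_pSeq_succ {σ1 σ2 : ℝ → ℂ} {t : ℝ} {d1 d2 : ℂ} (h1 : HasDerivAt σ1 d1 t)
    (h2 : HasDerivAt σ2 d2 t) (n : ℕ) :
    HasDerivAt (pSeq σ1 σ2 (n+1))
      ((n + 1) * (d1 * lucasSeq (σ1 t) (σ2 t) (n+1) - d2 * lucasSeq (σ1 t) (σ2 t) n)) t := by
  induction n using Nat.twoStepInduction with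
  | zero => simpa [pSeq, lucasSeq] using h1
  | one =>
    have h : HasDerivAt (fun t => σ1 t * σ1 t - σ2 t * 2)
        ((d1 * σ1 t + σ1 t * d1) - d2 * 2) t := (h1.mul h1).sub (h2.mul_const 2)
    have h' : HasDerivAt (pSeq σ1 σ2 (1+1)) _ t := h
    refine h'.congr_deriv ?_
    simp [lucasSeq]; ring
  | more n ih1 ih2 =>
    have h := (h1.mul ih2).sub (h2.mul ih1)
    have h' : HasDerivAt (pSeq σ1 σ2 (n+2+1)) _ t := h
    refine h'.congr_deriv ?_
    rw [pSeq_eq_lucasSeq, pSeq_eq_lucasSeq]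
    simp only [lucasSeq_add_two]
    push_cast
    ring

/-- The convolution of the power sums of two numbers. -/
lemma sum_pow_add_pow_mul (z w : ℂ) (m : ℕ) :
    ∑ i ∈ Finset.range m, (z ^ (i+1) + w ^ (i+1)) * (z ^ (m-i) + w ^ (m-i)) =
      m * (z ^ (m+1) + w ^ (m+1)) + 2 * (z * w) * lucasSeq (z + w) (z * w) m := by
  have h : ∀ i ∈ Finset.range m, (z ^ (i+1) + w ^ (i+1)) * (z ^ (m-i) + w ^ (m-i)) =
      (z ^ (m+1) + w ^ (m+1)) + z * w * (z ^ i * w ^ (m-1-i)) + z * w * (w ^ i * z ^ (m-1-i)) := by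
    intro i hi
    obtain ⟨j, rfl⟩ := Nat.exists_eq_add_of_lt (Finset.mem_range.1 hi)
    rw [show i + j + 1 - i = j + 1 by omega, show i + j + 1 - 1 - i = j by omega]
    ring
  rw [Finset.sum_congr rfl h, Finset.sum_add_distrib, Finset.sum_add_distrib, ← Finset.mul_sum,
    ← Finset.mul_sum, ← lucasSeq_eq_geom_sum, ← lucasSeq_eq_geom_sum, add_comm w z, mul_comm w z]
  simp
  ring

/-- A one-sided Schur–Cohn criterion. -/
lemma norm_lt_one_of_schurCohn {z w : ℂ} (h1 : ‖z * w‖ < 1)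
    (h2 : ‖(z + w) - (starRingEnd ℂ) (z + w) * (z * w)‖ < 1 - ‖z * w‖ ^ 2) : ‖z‖ < 1 := by
  by_contra! hz
  have e : (z + w) - (starRingEnd ℂ) (z + w) * (z * w) =
      z * ((1 - ‖w‖ ^ 2 : ℝ) : ℂ) - w * ((‖z‖ ^ 2 - 1 : ℝ) : ℂ) := by
    push_cast
    rw [← Complex.conj_mul', ← Complex.conj_mul', map_add]
    ring
  rw [norm_mul] at h1 h2
  have hw0 := norm_nonneg w
  have hw : ‖w‖ < 1 := by nlinarith
  have h3 := norm_sub_norm_le (z * ((1 - ‖w‖ ^ 2 : ℝ) : ℂ)) (w * ((‖z‖ ^ 2 - 1 : ℝ) : ℂ))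
  rw [← e, norm_mul, norm_mul, Complex.norm_real, Complex.norm_real,
    Real.norm_of_nonneg (by nlinarith), Real.norm_of_nonneg (by nlinarith)] at h3
  nlinarith [mul_nonneg (sub_nonneg.2 hz) (sub_nonneg.2 hw.le),
    mul_nonneg (mul_nonneg (sub_nonneg.2 hz) (sub_nonneg.2 hw.le)) (sub_nonneg.2 h1.le)]

/-- A pointwise bound on the roots of a circle of quadratics is uniform. -/
lemma exists_uniform_root_bound (A B C : ℂ)
    (h : ∀ e z : ℂ, ‖e‖ = 1 → z ^ 2 - (-A + B * e) * z - C * e = 0 → ‖z‖ < 1) :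
    ∃ r : ℝ, 0 ≤ r ∧ r < 1 ∧
      ∀ e z : ℂ, ‖e‖ = 1 → z ^ 2 - (-A + B * e) * z - C * e = 0 → ‖z‖ ≤ r := by
  let K : Set (ℂ × ℂ) := (Metric.sphere 0 1 ×ˢ Metric.closedBall 0 1) ∩
    {x | x.2 ^ 2 - (-A + B * x.1) * x.2 - C * x.1 = 0}
  have hK : IsCompact K :=
    ((isCompact_sphere _ _).prod (isCompact_closedBall _ _)).inter_right
      (isClosed_eq (by fun_prop) (by fun_prop))
  have mem : ∀ e z : ℂ, ‖e‖ = 1 → z ^ 2 - (-A + B * e) * z - C * e = 0 → (e, z) ∈ K :=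
    fun e z he hz => ⟨⟨by simpa using he, by simpa using (h e z he hz).le⟩, hz⟩
  rcases K.eq_empty_or_nonempty with hE | hN
  · refine ⟨0, le_rfl, one_pos, fun e z he hz => ?_⟩
    have := mem e z he hz
    simp [hE] at this
  · obtain ⟨x, hx, hmax⟩ := hK.exists_isMaxOn hN (f := fun x : ℂ × ℂ => ‖x.2‖) (by fun_prop)
    refine ⟨‖x.2‖, norm_nonneg _, h x.1 x.2 (by simpa using hx.1.1) hx.2, fun e z he hz => ?_⟩
    exact hmax (mem e z he hz)

lemma exists_add_mul_eq (s p : ℂ) : ∃ z w : ℂ, s = z + w ∧ p = z * w := by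
  obtain ⟨d, hd⟩ := IsAlgClosed.exists_pow_nat_eq (s ^ 2 - 4 * p) (n := 2) two_pos
  refine ⟨(s + d) / 2, (s - d) / 2, by ring, ?_⟩
  linear_combination (1 / 4) * hd

lemma eq_zero_of_eq_mul_succ {F : ℕ → ℂ} {b : ℂ} {M : ℝ} (hb : ‖b‖ < 1) (hM : ∀ n, ‖F n‖ ≤ M)
    (hF : ∀ n, F n = b * F (n+1)) (n : ℕ) : F n = 0 := by
  have h : ∀ j, ‖F n‖ ≤ ‖b‖ ^ j * M := by
    intro j
    have hj : F n = b ^ j * F (n + j) := by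
      induction j with
      | zero => simp
      | succ j ih => rw [ih, hF (n + j), pow_succ, mul_assoc, add_assoc]
    rw [hj, norm_mul, norm_pow]
    exact mul_le_mul_of_nonneg_left (hM _) (by positivity)
  have hlim : Filter.Tendsto (fun j : ℕ => ‖b‖ ^ j * M) Filter.atTop (nhds 0) := by
    simpa using (tendsto_pow_atTop_nhds_zero_of_lt_one (norm_nonneg b) hb).mul_const M
  exact norm_le_zero_iff.1 (ge_of_tendsto' hlim h)

/-- A bounded solution of a backward-stable linear recurrence vanishes. -/
lemma eq_zero_of_backward_recurrence {E : ℕ → ℂ} {a b : ℂ} {M : ℝ} (ha : ‖a‖ < 1) (hb : ‖b‖ < 1)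
    (hM : ∀ n, ‖E n‖ ≤ M) (hE : ∀ n, E n - (a + b) * E (n+1) + a * b * E (n+2) = 0) (n : ℕ) :
    E n = 0 := by
  refine eq_zero_of_eq_mul_succ hb hM (fun n => sub_eq_zero.1 ?_) n
  refine eq_zero_of_eq_mul_succ (F := fun n => E n - b * E (n+1)) (M := M + 1 * M) ha
    (fun n => ?_) (fun n => ?_) n
  · refine (norm_sub_le _ _).trans (add_le_add (hM _) ?_)
    rw [norm_mul]
    exact mul_le_mul hb.le (hM _) (norm_nonneg _) zero_le_one
  · linear_combination hE n

lemma norm_pow_add_pow_le {z w : ℂ} {r : ℝ} (hz : ‖z‖ ≤ r) (hw : ‖w‖ ≤ r) (n : ℕ) :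
    ‖z ^ n + w ^ n‖ ≤ 2 * r ^ n := by
  refine (norm_add_le _ _).trans ?_
  rw [norm_pow, norm_pow, two_mul]
  gcongr

lemma norm_correlation_term_le {z w : ℂ} {r : ℝ} (hr0 : 0 ≤ r) (hr : r < 1) (hz : ‖z‖ ≤ r)
    (hw : ‖w‖ ≤ r) (n j : ℕ) :
    ‖(z ^ n + w ^ n) * (starRingEnd ℂ) (z ^ (j+1) + w ^ (j+1))‖ ≤ 4 * r ^ j := by
  rw [norm_mul, Complex.norm_conj]
  have h1 : ‖z ^ n + w ^ n‖ ≤ 2 * 1 :=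
    (norm_pow_add_pow_le hz hw n).trans (by gcongr; exact pow_le_one₀ hr0 hr.le)
  have h2 : ‖z ^ (j+1) + w ^ (j+1)‖ ≤ 2 * r ^ j :=
    (norm_pow_add_pow_le hz hw (j+1)).trans
      (by gcongr 2 * ?_; exact pow_le_pow_of_le_one hr0 hr.le (Nat.le_succ j))
  calc _ ≤ (2 * 1) * (2 * r ^ j) := mul_le_mul h1 h2 (norm_nonneg _) (by norm_num)
    _ = _ := by ring

/-- The correlation sums of the power sums of `z, w` are identified by the backward recurrence
they satisfy. -/
lemma tsum_correlation_eq {z w : ℂ} {r : ℝ} (hr0 : 0 ≤ r) (hr : r < 1) (hz : ‖z‖ ≤ r)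
    (hw : ‖w‖ ≤ r) {X : ℕ → ℂ} {M : ℝ} (hXM : ∀ m, ‖X m‖ ≤ M)
    (hX : ∀ m, X m - (starRingEnd ℂ) (z + w) * X (m+1) + (starRingEnd ℂ) (z * w) * X (m+2) =
      (starRingEnd ℂ) (z + w) * (z ^ (m+2) + w ^ (m+2))
        - 2 * (starRingEnd ℂ) (z * w) * (z ^ (m+3) + w ^ (m+3))) (m : ℕ) :
    ∑' j : ℕ, (z ^ (m+2+j) + w ^ (m+2+j)) * (starRingEnd ℂ) (z ^ (j+1) + w ^ (j+1)) = X m := by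
  set T : ℕ → ℕ → ℂ := fun m j =>
    (z ^ (m+2+j) + w ^ (m+2+j)) * (starRingEnd ℂ) (z ^ (j+1) + w ^ (j+1)) with hT
  have hgeo : Summable (fun j : ℕ => 4 * r ^ j) :=
    (summable_geometric_of_lt_one hr0 hr).mul_left 4
  have hle : ∀ m j, ‖T m j‖ ≤ 4 * r ^ j := fun m j => norm_correlation_term_le hr0 hr hz hw _ _
  have hs : ∀ m, Summable (T m) := fun m => Summable.of_norm_bounded hgeo (hle m)
  refine sub_eq_zero.1 (eq_zero_of_backward_recurrence (E := fun m => ∑' j, T m j - X m)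
    (a := (starRingEnd ℂ) z) (b := (starRingEnd ℂ) w) (M := (∑' j : ℕ, 4 * r ^ j) + M)
    (by rw [Complex.norm_conj]; exact hz.trans_lt hr)
    (by rw [Complex.norm_conj]; exact hw.trans_lt hr) (fun m => ?_) (fun m => ?_) m)
  · exact (norm_sub_le _ _).trans
      (add_le_add (tsum_of_norm_bounded hgeo.hasSum (hle m)) (hXM m))
  · have e0 : ∑' j, T m j = T m 0 + T m 1 + ∑' j, T m (j+2) := by
      rw [← (hs m).sum_add_tsum_nat_add 2, Finset.sum_range_succ, Finset.sum_range_one]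
    have e1 : ∑' j, T (m+1) j = T (m+1) 0 + ∑' j, T (m+1) (j+1) := by
      rw [← (hs (m+1)).sum_add_tsum_nat_add 1, Finset.sum_range_one]
    have s0 : Summable fun j => T m (j+2) := (summable_nat_add_iff 2).2 (hs m)
    have s1 : Summable fun j => T (m+1) (j+1) := (summable_nat_add_iff 1).2 (hs (m+1))
    have e2 : ∑' j, T m (j+2) - (starRingEnd ℂ) (z + w) * ∑' j, T (m+1) (j+1)
        + (starRingEnd ℂ) (z * w) * ∑' j, T (m+2) j = 0 := by
      rw [← tsum_mul_left, ← tsum_mul_left, ← s0.tsum_sub (s1.mul_left _),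
        ← (s0.sub (s1.mul_left _)).tsum_add ((hs (m+2)).mul_left _)]
      convert tsum_zero with j
      simp only [hT, map_add, map_mul, map_pow]
      ring
    have e3 := hX m
    simp only [map_add, map_mul] at e2 e3
    have t0 : T m 0 = (z ^ (m+2) + w ^ (m+2)) * ((starRingEnd ℂ) z + (starRingEnd ℂ) w) := by
      simp [hT]
    have t1 : T m 1 = (z ^ (m+3) + w ^ (m+3)) *
        ((starRingEnd ℂ) z ^ 2 + (starRingEnd ℂ) w ^ 2) := by
      simp [hT]
    have t2 : T (m+1) 0 = (z ^ (m+3) + w ^ (m+3)) * ((starRingEnd ℂ) z + (starRingEnd ℂ) w) := by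
      simp [hT]
    rw [t0, t1] at e0
    rw [t2] at e1
    linear_combination e0 - ((starRingEnd ℂ) z + (starRingEnd ℂ) w) * e1 + e2 - e3

lemma summable_of_conj_symm {c : ℤ → ℂ} {r M : ℝ} (hr0 : 0 ≤ r) (hr : r < 1)
    (hc : ∀ n : ℕ, ‖c (n + 1)‖ ≤ M * r ^ n) (hneg : ∀ k, c (-k) = (starRingEnd ℂ) (c k)) :
    Summable (fun l => ‖c l‖) := by
  have h1 : Summable (fun n : ℕ => ‖c n‖) := by
    refine (summable_nat_add_iff 1).1 ?_
    refine Summable.of_nonneg_of_le (fun _ => norm_nonneg _) (fun n => ?_)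
      ((summable_geometric_of_lt_one hr0 hr).mul_left M)
    simpa using hc n
  refine Summable.of_nat_of_neg h1 ?_
  simpa [hneg] using h1

lemma summable_convolution {c : ℤ → ℂ} (h : Summable (fun l => ‖c l‖)) (k : ℤ) :
    Summable (fun l => ‖c l * c (k - l)‖) := by
  refine Summable.of_nonneg_of_le (fun _ => norm_nonneg _) (fun l => ?_)
    (h.mul_right (∑' l, ‖c l‖))
  rw [norm_mul]
  exact mul_le_mul_of_nonneg_left (h.le_tsum (k - l) (fun _ _ => norm_nonneg _)) (norm_nonneg _)

lemma tsum_convolution_succ {c : ℤ → ℂ} (h : Summable (fun l => ‖c l‖))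
    (hneg : ∀ k, c (-k) = (starRingEnd ℂ) (c k)) (m : ℕ) :
    ∑' l : ℤ, c l * c ((m + 1 : ℕ) - l) = 2 * c 0 * c (m + 1 : ℕ)
      + ∑ i ∈ Finset.range m, c (i + 1 : ℕ) * c (m - i : ℕ)
      + 2 * ∑' j : ℕ, c (m + 2 + j : ℕ) * (starRingEnd ℂ) (c (j + 1 : ℕ)) := by
  set f : ℤ → ℂ := fun l => c l * c ((m + 1 : ℕ) - l) with hf
  have hs : Summable f := (summable_convolution h _).of_norm
  have hp : Summable fun n : ℕ => f n := hs.comp_injective Nat.cast_injective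
  have hn : Summable fun n : ℕ => f (-(n + 1 : ℤ)) :=
    hs.comp_injective fun a b hab => by simpa using hab
  rw [(HasSum.of_nat_of_neg_add_one hp.hasSum hn.hasSum).tsum_eq, ← hp.sum_add_tsum_nat_add (m+2)]
  have e1 : ∀ n : ℕ, f (-(n + 1 : ℤ)) =
      c (m + 2 + n : ℕ) * (starRingEnd ℂ) (c (n + 1 : ℕ)) := by
    intro n
    simp only [hf]
    rw [hneg, mul_comm]
    push_cast
    congr 2
    ring
  have e2 : ∀ n : ℕ, f ((n + (m + 2) : ℕ) : ℤ) =
      c (m + 2 + n : ℕ) * (starRingEnd ℂ) (c (n + 1 : ℕ)) := by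
    intro n
    simp only [hf]
    rw [← hneg]
    push_cast
    congr 2 <;> ring
  have e3 : ∑ i ∈ Finset.range (m+2), f i = 2 * c 0 * c (m + 1 : ℕ)
      + ∑ i ∈ Finset.range m, c (i + 1 : ℕ) * c (m - i : ℕ) := by
    rw [Finset.sum_range_succ, Finset.sum_range_succ']
    have : ∀ i ∈ Finset.range m, f (i + 1 : ℕ) = c (i + 1 : ℕ) * c (m - i : ℕ) := by
      intro i hi
      simp only [hf]
      congr 2
      have := Finset.mem_range.1 hi
      omega
    rw [Finset.sum_congr rfl this]
    simp only [hf, Nat.cast_zero, sub_zero, sub_self]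
    ring
  simp_rw [e1, e2]
  rw [e3]
  ring

/-- The algebraic relations between the parameters, with `a = 3 - α0`. -/
structure ParamRel (a A B C ω : ℝ) : Prop where
  frequency : (A - B*C) * (ω - a + 2) = 2 * (A - 2*B*C)
  amplitude : (a - 2) * (B - A*C) = -2 * (B - 2*A*C)
  energy : (ω - 2*a + 2) * (1 - C^2) + (a - 2) * A * (A - B*C) - (ω - a + 2) * (B - A*C) * B
    = -2*A^2 + 8*A*B*C - 2*B^2 - 8*C^2
  oscillating : (1 - C^2) * B * a + (ω - 2*a - 2) * C * (A - B*C) = 0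
  stationary : (1 - C^2) * A * (ω - a) = (ω - 2*a - 2) * C * (B - A*C)

lemma lt_of_sq_bound {a C : ℝ} (ha : 2 < a) (hC : (a+2) * C^2 ≤ a - 2) :
    (a+2) * C < a := by
  refine lt_of_pow_lt_pow_left₀ 2 (by linarith) ?_
  nlinarith

lemma paramRel {a A B C ω : ℝ} (ha : 2 < a) (hC0 : 0 ≤ C) (hC : (a+2) * C^2 ≤ a - 2)
    (hA : A = a * Real.sqrt ((a - (a+4)*C^2) * ((a-2) - (a+2)*C^2)) / (a^2 - (a+2)^2*C^2))
    (hB : B = (a+2) * A * C / a)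
    (hω : ω = (a^2 - (a+2)^2*C^2) / (a - (a+2)*C^2)) : ParamRel a A B C ω := by
  have ha0 : a ≠ 0 := by linarith
  have hY : a - (a+2)*C^2 ≠ 0 := by linarith
  have hY' : a - C^2*(a+2) ≠ 0 := by linarith
  have hF : 0 < a - (a+2)*C := by linarith [lt_of_sq_bound ha hC]
  have hD : a^2 - (a+2)^2*C^2 ≠ 0 := by
    have : 0 < (a - (a+2)*C) * (a + (a+2)*C) := by positivity
    nlinarith
  have hN : 0 ≤ (a - (a+4)*C^2) * ((a-2) - (a+2)*C^2) :=
    mul_nonneg (by nlinarith) (by linarith)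
  have hA2 : A^2 = a^2 * ((a - (a+4)*C^2) * ((a-2) - (a+2)*C^2)) / (a^2 - (a+2)^2*C^2)^2 := by
    rw [hA, div_pow, mul_pow, Real.sq_sqrt hN]
  clear hA
  subst hB hω
  refine ⟨?_, ?_, ?_, ?_, ?_⟩
  · field_simp; ring
  · field_simp; ring
  · trans (a^2 - (a+2)^2*C^2) / (a - (a+2)*C^2) * (1 - C^2) + (2 - 2*a) * (1 - C^2)
      + A^2 * ((a - 2) * (1 - (a+2)*C^2/a)
        - ((a^2 - (a+2)^2*C^2) / (a - (a+2)*C^2) - a + 2) * (2*C/a) * ((a+2)*C/a))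
    · field_simp; ring
    · trans A^2 * (-2 + 8*(a+2)*C^2/a - 2*((a+2)*C/a)^2) - 8*C^2
      · rw [hA2]; field_simp; ring
      · field_simp
  · field_simp; ring
  · field_simp; ring

lemma param_schurCohn {a A B C : ℝ} (ha : 2 < a) (hC0 : 0 ≤ C) (hC : (a+2) * C^2 ≤ a - 2)
    (hA : A = a * Real.sqrt ((a - (a+4)*C^2) * ((a-2) - (a+2)*C^2)) / (a^2 - (a+2)^2*C^2))
    (hB : B = (a+2) * A * C / a) : |A - B*C| + |B - A*C| < 1 - C^2 := by
  have hF : 0 < a - (a+2)*C := by linarith [lt_of_sq_bound ha hC]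
  have hG : 0 < a + (a+2)*C := by positivity
  have hC1 : C < 1 := by nlinarith
  have hD : a^2 - (a+2)^2*C^2 = (a - (a+2)*C) * (a + (a+2)*C) := by ring
  have hN : 0 ≤ (a - (a+4)*C^2) * ((a-2) - (a+2)*C^2) :=
    mul_nonneg (by nlinarith) (by linarith)
  have hA0 : 0 ≤ A := by rw [hA, hD]; positivity
  have hAG : A * (a + (a+2)*C) < a * (1 + C) := by
    have h : A * (a + (a+2)*C) * (a - (a+2)*C)
        = a * Real.sqrt ((a - (a+4)*C^2) * ((a-2) - (a+2)*C^2)) := by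
      have hF' : a - C*(a+2) ≠ 0 := by linarith
      rw [hA, hD]; field_simp
    have h2 : Real.sqrt ((a - (a+4)*C^2) * ((a-2) - (a+2)*C^2)) < (1 + C) * (a - (a+2)*C) := by
      rw [Real.sqrt_lt' (by positivity)]
      have : 0 < 2 * (a - (a+2)*C^2) * (1 - C)^2 := by
        have : 0 < 1 - C := by linarith
        have : 0 < a - (a+2)*C^2 := by linarith
        positivity
      nlinarith
    have h3 : A * (a + (a+2)*C) * (a - (a+2)*C) < a * (1 + C) * (a - (a+2)*C) := by
      rw [h, mul_assoc]; gcongr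
    exact lt_of_mul_lt_mul_right h3 hF.le
  have eP : A - B*C = A * (a - (a+2)*C^2) / a := by rw [hB]; field_simp
  have eQ : B - A*C = 2 * A * C / a := by rw [hB]; field_simp; ring
  rw [eP, eQ, abs_of_nonneg (div_nonneg (mul_nonneg hA0 (by linarith)) (by linarith)),
    abs_of_nonneg (by positivity), ← add_div, div_lt_iff₀ (by linarith)]
  nlinarith [mul_lt_mul_of_pos_left hAG (sub_pos.2 hC1)]

lemma norm_root_lt_one {A B C : ℝ} (hC0 : 0 ≤ C) (hC1 : C < 1)
    (h : |A - B*C| + |B - A*C| < 1 - C^2) (e z : ℂ) (he : ‖e‖ = 1)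
    (hz : z ^ 2 - (-(A : ℂ) + B * e) * z - C * e = 0) : ‖z‖ < 1 := by
  have hzw : z * ((-A + B * e) - z) = -(C * e) := by linear_combination -hz
  have hn : ‖z * ((-A + B * e) - z)‖ = C := by
    rw [hzw, norm_neg, norm_mul, he, mul_one, Complex.norm_real, Real.norm_of_nonneg hC0]
  refine norm_lt_one_of_schurCohn (w := (-A + B * e) - z) (by rwa [hn]) ?_
  rw [hn, hzw, add_sub_cancel]
  have hee : (starRingEnd ℂ) e * e = 1 := by rw [Complex.conj_mul', he]; simp
  have key : (-A + B * e) - (starRingEnd ℂ) (-A + B * e) * (-(C * e))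
      = -((A - B*C : ℝ) : ℂ) + ((B - A*C : ℝ) : ℂ) * e := by
    simp only [map_add, map_neg, map_mul, Complex.conj_ofReal]
    push_cast
    linear_combination (B * C : ℂ) * hee
  rw [key]
  refine (norm_add_le _ _).trans_lt ?_
  rwa [norm_neg, norm_mul, he, mul_one, Complex.norm_real, Complex.norm_real, Real.norm_eq_abs,
    Real.norm_eq_abs]

/-- The closed form of the correlation sums on the solution. -/
def correlationSeq (a B ω : ℝ) (s p q : ℂ) (m : ℕ) : ℂ :=
  (((a : ℂ) - 2) * s - ω * B * q) / 2 * lucasSeq s p (m+1)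
    + ((ω : ℂ) - 2*a + 2) / 2 * p * lucasSeq s p m

lemma correlationSeq_recurrence {a A B C ω : ℝ} (h : ParamRel a A B C ω)
    {e e' d d' s p s' p' : ℂ} (he : e * e' = 1) (hd : d * d' = 1)
    (hs : s = (-A + B * e) * d) (hp : p = -C * e * d^2)
    (hs' : s' = (-A + B * e') * d') (hp' : p' = -C * e' * d'^2) (m : ℕ) :
    correlationSeq a B ω s p (e * d) m - s' * correlationSeq a B ω s p (e * d) (m+1)
        + p' * correlationSeq a B ω s p (e * d) (m+2)
      = s' * (2 * lucasSeq s p (m+3) - s * lucasSeq s p (m+2))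
        - 2 * p' * (2 * lucasSeq s p (m+4) - s * lucasSeq s p (m+3)) := by
  obtain ⟨E1, E2, E3, E4, E5⟩ := h
  replace E1 := congrArg (fun x : ℝ => (x : ℂ)) E1
  replace E2 := congrArg (fun x : ℝ => (x : ℂ)) E2
  replace E3 := congrArg (fun x : ℝ => (x : ℂ)) E3
  replace E4 := congrArg (fun x : ℝ => (x : ℂ)) E4
  replace E5 := congrArg (fun x : ℝ => (x : ℂ)) E5
  push_cast at E1 E2 E3 E4 E5
  obtain ⟨s1, hs1⟩ : ∃ x : ℂ, x = -A + B * e := ⟨_, rfl⟩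
  obtain ⟨s2, hs2⟩ : ∃ x : ℂ, x = -C * e := ⟨_, rfl⟩
  obtain ⟨t1, ht1⟩ : ∃ x : ℂ, x = -A + B * e' := ⟨_, rfl⟩
  obtain ⟨t2, ht2⟩ : ∃ x : ℂ, x = -C * e' := ⟨_, rfl⟩
  obtain ⟨α, hα⟩ : ∃ x : ℂ, x = (((a : ℂ) - 2) * s1 - ω * B * e) / 2 := ⟨_, rfl⟩
  obtain ⟨b, hb⟩ : ∃ x : ℂ, x = ((ω : ℂ) - 2*a + 2) / 2 := ⟨_, rfl⟩
  have c2 : b + t1*α - t2*(α*s1 + b*s2) + t1*s1 - 2*t2*s1^2 + 4*t2*s2 = 0 := by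
    rw [hα, hb, hs1, hs2, ht1, ht2]
    linear_combination (B*e/2) * E1 - (A*e'/2) * E2 + (1/2) * E3
      + ((a-2-ω)*B^2/2 + C/2*(-(2*(a-2)-ω)*A*B + (a-2-ω)*B^2*e) - ((ω : ℂ) - 2*a + 2) / 2*C^2
        + B^2 + 2*C*(-2*A*B+B^2*e) + 4*C^2) * he
  have c12 : (α + b*s1)*(1 - t2*s2) - (b-2)*s2*(t1 - t2*s1) = 0 := by
    rw [hα, hb, hs1, hs2, ht1, ht2]
    linear_combination (-e/2) * E4 - (1/2) * E5
      + ((((ω : ℂ) - 2*a + 2) / 2 - 2)*C*(B - A*C + B*C*e)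
        - ((((a : ℂ) - 2) * (-A + B * e) - ω * B * e) / 2
          + ((ω : ℂ) - 2*a + 2) / 2 * (-A + B * e))*C^2) * he
  have d1 : d' * d^2 = d := by linear_combination d * hd
  have d2 : d'^2 * d^3 = d := by linear_combination (d*(d*d'+1)) * hd
  have hs1' : s = s1 * d := by rw [hs, hs1]
  have hp1' : p = s2 * d^2 := by rw [hp, hs2]
  have hα' : (((a : ℂ) - 2) * s - ω * B * (e * d)) / 2 = α * d := by rw [hα, hs1']; ring
  simp only [correlationSeq, ← hb, hα', lucasSeq_add_two]
  rw [hs', hp', ← ht1, ← ht2, hs1', hp1']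
  generalize lucasSeq (s1 * d) (s2 * d^2) (m+1) = g1
  generalize lucasSeq (s1 * d) (s2 * d^2) m = g0
  linear_combination (d * g1) * (c12 - s1 * c2) + (d^2 * s2 * g0) * c2
    + (g1 * (-t1*(α*s1+b*s2) - t1*(s1^2-2*s2))
      + g0 * d * s2 * (t1*α + t1*s1)) * d1
    + (g1 * (t2*(α*s1^2+b*s1*s2-s2*α) + 2*t2*(s1^3-3*s1*s2))
      + g0 * d * s2 * (-t2*(α*s1+b*s2) - 2*t2*s1^2 + 4*t2*s2)) * d2

theorem exact_two_particle_solutions_solve_BO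
    (α0 θ t0 C : ℝ) (hα : α0 < 1)
    (hC0 : 0 ≤ C) (hC1 : C ≤ Real.sqrt ((1 - α0) / (5 - α0)))
    (A B ω : ℝ)
    (hA : A = (3 - α0) *
        Real.sqrt (((3 - α0) - (7 - α0) * C^2) * ((1 - α0) - (5 - α0) * C^2))
        / ((3 - α0)^2 - (5 - α0)^2 * C^2))
    (hB : B = (5 - α0) * A * C / (3 - α0))
    (hω : ω = ((3 - α0)^2 - (5 - α0)^2 * C^2) / ((3 - α0) - (5 - α0) * C^2))
    (σ1 σ2 : ℝ → ℂ)
    (hσ1 : ∀ t : ℝ, σ1 t =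
      (-(A : ℂ) + (B : ℂ) * Complex.exp (Complex.I * ω * (t - t0))) *
        Complex.exp (-Complex.I * θ))
    (hσ2 : ∀ t : ℝ, σ2 t =
      (-(C : ℂ) * Complex.exp (Complex.I * ω * (t - t0))) *
        Complex.exp (-2 * Complex.I * θ))
    (c : ℤ → ℝ → ℂ)
    (hc0 : ∀ t : ℝ, c 0 t = (α0 : ℂ))
    (hcpos : ∀ k : ℤ, 0 < k → ∀ t : ℝ, c k t = 2 * pSeq σ1 σ2 k.toNat t)
    (hcneg : ∀ k : ℤ, k < 0 → ∀ t : ℝ, c k t = (starRingEnd ℂ) (c (-k) t)) :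
    0 < ω ∧
    (∃ r : ℝ, r < 1 ∧ ∀ k : ℕ, 1 ≤ k → ∀ t : ℝ, ‖pSeq σ1 σ2 k t‖ ≤ 2 * r ^ k) ∧
    SolvesBOFourier c ∧
    (∀ (k : ℤ) (t : ℝ), c k (t + 2 * Real.pi / ω) = c k t) := by
  have ha : 2 < 3 - α0 := by linarith
  have h5 : 0 < 5 - α0 := by linarith
  have hC2 : (3 - α0 + 2) * C^2 ≤ 3 - α0 - 2 := by
    have h := (Real.le_sqrt hC0 (div_nonneg (by linarith) h5.le)).1 hC1
    rw [le_div_iff₀ h5] at h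
    linarith
  have hA' : A = (3 - α0) * Real.sqrt (((3 - α0) - ((3 - α0)+4)*C^2)
      * (((3 - α0)-2) - ((3 - α0)+2)*C^2)) / ((3 - α0)^2 - ((3 - α0)+2)^2*C^2) := by
    rw [hA]; ring_nf
  have hB' : B = ((3 - α0)+2) * A * C / (3 - α0) := by rw [hB]; ring_nf
  have hω' : ω = ((3 - α0)^2 - ((3 - α0)+2)^2*C^2) / ((3 - α0) - ((3 - α0)+2)*C^2) := by
    rw [hω]; ring_nf
  have hrel := paramRel ha hC0 hC2 hA' hB' hω'
  have hF := lt_of_sq_bound ha hC2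
  have hωpos : 0 < ω := by
    rw [hω']
    refine div_pos ?_ (by linarith)
    have : 0 < ((3 - α0) - ((3 - α0)+2)*C) * ((3 - α0) + ((3 - α0)+2)*C) :=
      mul_pos (by linarith) (by positivity)
    linarith
  obtain ⟨r, hr0, hr1, hr⟩ := exists_uniform_root_bound A B C
    (norm_root_lt_one hC0 (by nlinarith) (param_schurCohn ha hC0 hC2 hA' hB'))
  set e : ℝ → ℂ := fun t => Complex.exp (Complex.I * ω * (t - t0)) with he
  set d : ℂ := Complex.exp (-Complex.I * θ) with hd
  have hd2 : Complex.exp (-2 * Complex.I * θ) = d^2 := by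
    rw [hd, ← Complex.exp_nat_mul]; congr 1; push_cast; ring
  have hen : ∀ t, ‖e t‖ = 1 := fun t => by simp [he, Complex.norm_exp]
  have hdn : ‖d‖ = 1 := by simp [hd, Complex.norm_exp]
  have hec : ∀ t, e t * (starRingEnd ℂ) (e t) = 1 := fun t => by
    rw [Complex.mul_conj', hen]; simp
  have hdc : d * (starRingEnd ℂ) d = 1 := by rw [Complex.mul_conj', hdn]; simp
  have hs1 : ∀ t, σ1 t = (-A + B * e t) * d := hσ1
  have hs2 : ∀ t, σ2 t = -C * e t * d^2 := fun t => by rw [hσ2, hd2]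
  have hroot : ∀ t (z w : ℂ), σ1 t = z + w → σ2 t = z * w → ‖z‖ ≤ r := by
    intro t z w h1 h2
    have h := hr (e t) (z * (starRingEnd ℂ) d) (hen t) (by
      linear_combination (-z * ((starRingEnd ℂ) d)^2) * (h1 - hs1 t)
        + ((starRingEnd ℂ) d)^2 * (h2 - hs2 t)
        + ((-A + B * e t) * z * (starRingEnd ℂ) d
          + C * e t * (d * (starRingEnd ℂ) d + 1)) * hdc)
    rwa [norm_mul, Complex.norm_conj, hdn, mul_one] at h
  have hroots : ∀ t, ∃ z w : ℂ, σ1 t = z + w ∧ σ2 t = z * w ∧ ‖z‖ ≤ r ∧ ‖w‖ ≤ r := by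
    intro t
    obtain ⟨z, w, h1, h2⟩ := exists_add_mul_eq (σ1 t) (σ2 t)
    exact ⟨z, w, h1, h2, hroot t z w h1 h2,
      hroot t w z (by rw [h1, add_comm]) (by rw [h2, mul_comm])⟩
  have hP : ∀ (n : ℕ) (t : ℝ), ‖pSeq σ1 σ2 n t‖ ≤ 2 * r ^ n := by
    intro n t
    obtain ⟨z, w, h1, h2, hz, hw⟩ := hroots t
    rw [pSeq_eq_pow_add_pow h1 h2]
    exact norm_pow_add_pow_le hz hw n
  have hcn : ∀ (n : ℕ) (t : ℝ), c (n + 1 : ℕ) t = 2 * pSeq σ1 σ2 (n+1) t := fun n t => by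
    rw [hcpos _ (by omega), Int.toNat_natCast]
  have hconj : ∀ (k : ℤ) (t : ℝ), c (-k) t = (starRingEnd ℂ) (c k t) := by
    intro k t
    rcases lt_trichotomy k 0 with hk | rfl | hk
    · rw [hcneg k hk, Complex.conj_conj]
    · simp [hc0]
    · rw [hcneg (-k) (by omega), neg_neg]
  have hsum : ∀ t, Summable (fun l => ‖c l t‖) := fun t =>
    summable_of_conj_symm (c := fun l => c l t) (M := 4 * r) hr0 hr1
      (fun n => by
        have h1 := hcn n t
        have h2 := hP (n+1) t
        push_cast at h1
        simp only [h1, norm_mul, Complex.norm_ofNat]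
        rw [pow_succ] at h2
        linarith)
      (fun k => hconj k t)
  have hed : ∀ t, HasDerivAt e (Complex.I * ω * e t) t := by
    intro t
    have h : HasDerivAt (fun t : ℝ => Complex.I * ω * ((t : ℂ) - t0)) (Complex.I * ω * 1) t :=
      ((Complex.ofRealCLM.hasDerivAt (x := t)).sub_const (t0 : ℂ)).const_mul _
    exact h.cexp.congr_deriv (by simp only [he]; ring)
  have hd1 : ∀ t, HasDerivAt σ1 (Complex.I * ω * B * (e t * d)) t := by
    intro t
    rw [show σ1 = fun t => (-A + B * e t) * d from funext hs1]
    exact ((((hed t).const_mul (B : ℂ)).const_add (-A : ℂ)).mul_const d).congr_deriv (by ring)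
  have hd2 : ∀ t, HasDerivAt σ2 (Complex.I * ω * σ2 t) t := by
    intro t
    rw [show σ2 = fun t => -C * e t * d^2 from funext hs2]
    exact (((hed t).const_mul (-C : ℂ)).mul_const (d^2)).congr_deriv (by ring)
  have hcd : ∀ (n : ℕ) (t : ℝ), HasDerivAt (c (n + 1 : ℕ))
      (2 * ((n + 1) * (Complex.I * ω * B * (e t * d) * lucasSeq (σ1 t) (σ2 t) (n+1)
        - Complex.I * ω * σ2 t * lucasSeq (σ1 t) (σ2 t) n))) t := by
    intro n t
    rw [show c (n + 1 : ℕ) = fun t => 2 * pSeq σ1 σ2 (n+1) t from funext (hcn n)]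
    exact (hasDerivAt_pSeq_succ (hd1 t) (hd2 t) n).const_mul 2
  have hcorr : ∀ (m : ℕ) (t : ℝ), ∑' j : ℕ, pSeq σ1 σ2 (m+2+j) t
      * (starRingEnd ℂ) (pSeq σ1 σ2 (j+1) t)
        = correlationSeq (3 - α0) B ω (σ1 t) (σ2 t) (e t * d) m := by
    intro m t
    obtain ⟨z, w, h1, h2, hz, hw⟩ := hroots t
    simp_rw [pSeq_eq_pow_add_pow h1 h2]
    have hg : ∀ n, ‖lucasSeq (σ1 t) (σ2 t) n‖ ≤ 1 / (1 - r) := fun n => by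
      rw [h1, h2]; exact norm_lucasSeq_le hr1 hz hw n
    refine tsum_correlation_eq hr0 hr1 hz hw
      (M := ‖(((3 - α0 : ℝ) : ℂ) - 2) * σ1 t / 2 - ω * B * (e t * d) / 2‖ * (1 / (1 - r))
        + ‖((ω : ℂ) - 2*(3 - α0 : ℝ) + 2) / 2 * σ2 t‖ * (1 / (1 - r)))
      (fun m => ?_) (fun m => ?_) m
    · refine (norm_add_le _ _).trans ?_
      rw [norm_mul, norm_mul, ← sub_div]
      gcongr
      · exact hg _
      · exact hg _
    · rw [← h1, ← h2, ← pSeq_eq_pow_add_pow h1 h2, ← pSeq_eq_pow_add_pow h1 h2,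
        pSeq_eq_lucasSeq, pSeq_eq_lucasSeq]
      exact correlationSeq_recurrence hrel (hec t) hdc (hs1 t) (hs2 t)
        (by rw [hs1]; simp) (by rw [hs2]; simp) m
  have hode : ∀ (m : ℕ) (t : ℝ), HasDerivAt (c (m + 1 : ℕ))
      (Complex.I * ((m + 1 : ℕ) : ℤ) * ((|((m + 1 : ℕ) : ℤ)| : ℤ) : ℂ) * c (m + 1 : ℕ) t
        - Complex.I * ((m + 1 : ℕ) : ℤ) / 2 * ∑' l : ℤ, c l t * c ((m + 1 : ℕ) - l) t) t := by
    intro m t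
    refine (hcd m t).congr_deriv ?_
    obtain ⟨z, w, h1, h2, -, -⟩ := hroots t
    have hconv : ∑ i ∈ Finset.range m, c (i + 1 : ℕ) t * c (m - i : ℕ) t
        = 4 * (m * pSeq σ1 σ2 (m+1) t + 2 * σ2 t * lucasSeq (σ1 t) (σ2 t) m) := by
      rw [pSeq_eq_pow_add_pow h1 h2, h1, h2, ← sum_pow_add_pow_mul, Finset.mul_sum]
      refine Finset.sum_congr rfl fun i hi => ?_
      obtain ⟨j, rfl⟩ := Nat.exists_eq_add_of_lt (Finset.mem_range.1 hi)
      rw [show i + j + 1 - i = j + 1 by omega, hcn, hcn, pSeq_eq_pow_add_pow h1 h2,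
        pSeq_eq_pow_add_pow h1 h2]
      ring
    have htail : ∑' j : ℕ, c (m + 2 + j : ℕ) t * (starRingEnd ℂ) (c (j + 1 : ℕ) t)
        = 4 * correlationSeq (3 - α0) B ω (σ1 t) (σ2 t) (e t * d) m := by
      rw [← hcorr, ← tsum_mul_left]
      refine tsum_congr fun j => ?_
      rw [show m + 2 + j = (m + 1 + j) + 1 by ring, hcn, hcn, map_mul, Complex.conj_ofNat]
      ring
    rw [tsum_convolution_succ (c := fun l => c l t) (hsum t) (fun k => hconj k t), hconv, htail,
      hc0, hcn, abs_of_nonneg (by positivity), pSeq_eq_lucasSeq, correlationSeq, lucasSeq_add_two]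
    push_cast
    ring
  have hodeneg : ∀ (m : ℕ) (t : ℝ), HasDerivAt (c (-(m + 1 : ℕ)))
      (Complex.I * (-((m + 1 : ℕ) : ℤ) : ℤ) * ((|(-((m + 1 : ℕ) : ℤ))| : ℤ) : ℂ)
          * c (-(m + 1 : ℕ)) t
        - Complex.I * (-((m + 1 : ℕ) : ℤ) : ℤ) / 2
          * ∑' l : ℤ, c l t * c (-(m + 1 : ℕ) - l) t) t := by
    intro m t
    rw [show c (-(m + 1 : ℕ)) = fun t => (starRingEnd ℂ) (c (m + 1 : ℕ) t) from
      funext (hconj _)]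
    refine (hode m t).star.congr_deriv ?_
    have hts : ∑' l : ℤ, c l t * c (-(m + 1 : ℕ) - l) t
        = (starRingEnd ℂ) (∑' l : ℤ, c l t * c ((m + 1 : ℕ) - l) t) := by
      rw [Complex.conj_tsum, ← (Equiv.neg ℤ).tsum_eq]
      refine tsum_congr fun l => ?_
      rw [map_mul, ← hconj, ← hconj, Equiv.neg_apply]
      congr 2
      ring
    rw [hts, abs_neg]
    simp
    ring
  have hder : ∀ (k : ℤ) (t : ℝ), HasDerivAt (c k) (Complex.I * (k : ℂ) * ((|k| : ℤ) : ℂ) * c k t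
      - Complex.I * (k : ℂ) / 2 * ∑' l : ℤ, c l t * c (k - l) t) t := by
    intro k t
    rcases lt_trichotomy k 0 with hk | rfl | hk
    · obtain ⟨m, rfl⟩ : ∃ m : ℕ, k = -((m + 1 : ℕ) : ℤ) := ⟨(-k - 1).toNat, by omega⟩
      exact hodeneg m t
    · rw [show c 0 = fun _ => (α0 : ℂ) from funext hc0]
      simpa using hasDerivAt_const t (α0 : ℂ)
    · obtain ⟨m, rfl⟩ : ∃ m : ℕ, k = ((m + 1 : ℕ) : ℤ) := ⟨(k - 1).toNat, by omega⟩
      exact hode m t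
  have hper : ∀ t, e (t + 2 * Real.pi / ω) = e t := by
    intro t
    have hω0 : (ω : ℂ) ≠ 0 := by exact_mod_cast hωpos.ne'
    have : Complex.I * ω * (((t + 2 * Real.pi / ω : ℝ) : ℂ) - t0)
        = Complex.I * ω * (t - t0) + 2 * Real.pi * Complex.I := by
      push_cast; field_simp; ring
    simp only [he]
    rw [this, Complex.exp_periodic]
  have hpper : ∀ (n : ℕ) (t : ℝ), pSeq σ1 σ2 n (t + 2 * Real.pi / ω) = pSeq σ1 σ2 n t :=
    fun n t => pSeq_congr (by rw [hs1, hs1, hper]) (by rw [hs2, hs2, hper]) n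
  refine ⟨hωpos, ⟨r, hr1, fun k _ t => hP k t⟩, ⟨fun k t => (hder k t).differentiableAt, hconj,
    fun k t => summable_convolution (hsum t) k, fun k t => (hder k t).deriv⟩, fun k t => ?_⟩
  rcases lt_trichotomy k 0 with hk | rfl | hk
  · rw [hcneg k hk, hcneg k hk, hcpos _ (by omega), hcpos _ (by omega), hpper]
  · rw [hc0, hc0]
  · rw [hcpos k hk, hcpos k hk, hpper]

end
end

section
/- Fix α0 < 1 and C with 0 ≤ C ≤ sqrt((1−α0)/(5−α0)), define A, B, ω from α0 and C as in the parameter definitions, and set σ1(t) = −A + B e^{iωt}, σ2(t) = −C e^{iωt}. Then for every t ∈ ℝ: Q(σ1(t),σ2(t)) ≠ 0, σ1'(t) = −2i P1(σ1(t),σ2(t)) / Q(σ1(t),σ2(t)) + i(1−α0) σ1(t), and σ2'(t) = −2i P2(σ1(t),σ2(t)) σ2(t) / Q(σ1(t),σ2(t)) + 2i(2−α0) σ2(t). -/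
open Complex

noncomputable section

/-- `P1(σ₁,σ₂)`: numerator in the `σ₁` pole-dynamics equation. -/
noncomputable def P1 (s1 s2 : ℂ) : ℂ :=
  s1^2 * (starRingEnd ℂ) s1 - 2 * (starRingEnd ℂ) s1 * s2
    - 2 * s1^3 * (starRingEnd ℂ) s2 + 6 * s1 * (Complex.normSq s2 : ℂ)
    - s1 * ((starRingEnd ℂ) s1)^2 * s2
    + 2 * s1^2 * (starRingEnd ℂ) s1 * (Complex.normSq s2 : ℂ)
    - 2 * (starRingEnd ℂ) s1 * s2^2 * (starRingEnd ℂ) s2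
    - 2 * s1 * (Complex.normSq s2 : ℂ)^2

/-- `P2(σ₁,σ₂)`: numerator in the `σ₂` pole-dynamics equation. -/
noncomputable def P2 (s1 s2 : ℂ) : ℂ :=
  (Complex.normSq s1 : ℂ) * (1 + 3 * (Complex.normSq s2 : ℂ))
    + 4 * (Complex.normSq s2 : ℂ) * (1 - (Complex.normSq s2 : ℂ))
    - 2 * (s1^2 * (starRingEnd ℂ) s2 + ((starRingEnd ℂ) s1)^2 * s2)

/-- `Q(σ₁,σ₂)`: common denominator in the pole-dynamics equations. -/
noncomputable def Qf (s1 s2 : ℂ) : ℂ :=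
  (1 - (Complex.normSq s2 : ℂ))^2
    - (Complex.normSq s1 : ℂ) * (1 + (Complex.normSq s2 : ℂ))
    + (s1^2 * (starRingEnd ℂ) s2 + ((starRingEnd ℂ) s1)^2 * s2)

/-- The quadratic form bounding `Qf` along the orbit is positive for every cosine `c ∈ [-1, 1]`. -/
theorem denominator_pos_of_amplitude_relation {s C A c : ℝ} (hs : 2 < s) (hC0 : 0 ≤ C)
    (hC : (s + 2) * C ^ 2 ≤ s - 2)
    (hA : (s ^ 2 - (s + 2) ^ 2 * C ^ 2) ^ 2 * A ^ 2
      = s ^ 2 * ((s - (s + 4) * C ^ 2) * ((s - 2) - (s + 2) * C ^ 2)))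
    (hc1 : -1 ≤ c) (hc2 : c ≤ 1) :
    0 < s ^ 2 * (1 - C ^ 2) ^ 2 - A ^ 2 * ((s ^ 2 + (s + 2) ^ 2 * C ^ 2) * (1 + C ^ 2)
      - 4 * s * (s + 2) * C ^ 2 - 4 * c * C * (s - (s + 2) * C ^ 2)) := by
  have hC1 : C < 1 := by
    by_contra! h
    nlinarith [mul_le_mul h h zero_le_one hC0]
  have hplus : 0 < s + (s + 2) * C := by positivity
  have hminus : 0 < s - (s + 2) * C := by
    have : ((s + 2) * C) ^ 2 < s ^ 2 := by nlinarith
    nlinarith [abs_lt_of_sq_lt_sq this (by linarith), le_abs_self ((s + 2) * C)]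
  have amgm : (s - (s + 4) * C ^ 2) * ((s - 2) - (s + 2) * C ^ 2)
      ≤ (s - 1 - (s + 3) * C ^ 2) ^ 2 := by
    nlinarith [sq_nonneg (1 - C ^ 2)]
  have hmid : 0 ≤ s - 1 - (s + 3) * C ^ 2 := by nlinarith
  have hfac : (s ^ 2 - (s + 2) ^ 2 * C ^ 2) = (s - (s + 2) * C) * (s + (s + 2) * C) := by ring
  rw [hfac] at hA
  have key : ∀ u v w : ℝ, 0 < u → 0 < v → s - 1 - (s + 3) * C ^ 2 < w * u →
      (u * v) ^ 2 * A ^ 2 = s ^ 2 * ((s - (s + 4) * C ^ 2) * ((s - 2) - (s + 2) * C ^ 2)) →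
      0 < s ^ 2 * w ^ 2 - A ^ 2 * v ^ 2 := by
    intro u v w hu hv hw h
    have h1 : (s - 1 - (s + 3) * C ^ 2) ^ 2 < (w * u) ^ 2 := by gcongr
    have h2 : 0 < s ^ 2 * ((w * u) ^ 2
        - (s - (s + 4) * C ^ 2) * ((s - 2) - (s + 2) * C ^ 2)) := by
      have : 0 < (w * u) ^ 2
        - (s - (s + 4) * C ^ 2) * ((s - 2) - (s + 2) * C ^ 2) := by linarith
      positivity
    have h3 : 0 < u ^ 2 * (s ^ 2 * w ^ 2 - A ^ 2 * v ^ 2) := by linarith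
    exact pos_of_mul_pos_right h3 (by positivity)
  have hm := key (s - (s + 2) * C) (s + (s + 2) * C) (1 + C) hminus hplus
    (by nlinarith [sq_pos_of_pos (sub_pos.2 hC1)]) hA
  have hp := key (s + (s + 2) * C) (s - (s + 2) * C) (1 - C) hplus hminus
    (by nlinarith [sq_nonneg C]) (by rw [← hA]; ring)
  have hm' := mul_pos (pow_pos (sub_pos.2 hC1) 2) hm
  have hp' := mul_pos (pow_pos (by linarith : 0 < 1 + C) 2) hp
  rcases eq_or_lt_of_le hc1 with rfl | hc1'
  · linarith
  · linarith [mul_pos (by linarith : 0 < 1 + c) hp',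
      mul_nonneg (by linarith : 0 ≤ 1 - c) hm'.le]

theorem sigma_orbits_satisfy_pole_dynamics
    (α0 C : ℝ) (hα : α0 < 1)
    (hC0 : 0 ≤ C) (hC1 : C ≤ Real.sqrt ((1 - α0) / (5 - α0)))
    (A B ω : ℝ)
    (hA : A = (3 - α0) *
        Real.sqrt (((3 - α0) - (7 - α0) * C^2) * ((1 - α0) - (5 - α0) * C^2))
        / ((3 - α0)^2 - (5 - α0)^2 * C^2))
    (hB : B = (5 - α0) * A * C / (3 - α0))
    (hω : ω = ((3 - α0)^2 - (5 - α0)^2 * C^2) / ((3 - α0) - (5 - α0) * C^2))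
    (σ1 σ2 : ℝ → ℂ)
    (hσ1 : ∀ t : ℝ, σ1 t = -(A : ℂ) + (B : ℂ) * Complex.exp (Complex.I * ω * t))
    (hσ2 : ∀ t : ℝ, σ2 t = -(C : ℂ) * Complex.exp (Complex.I * ω * t)) :
    ∀ t : ℝ,
      Qf (σ1 t) (σ2 t) ≠ 0 ∧
      deriv σ1 t = -2 * Complex.I * P1 (σ1 t) (σ2 t) / Qf (σ1 t) (σ2 t)
        + Complex.I * (1 - α0) * σ1 t ∧
      deriv σ2 t = -2 * Complex.I * P2 (σ1 t) (σ2 t) * σ2 t / Qf (σ1 t) (σ2 t)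
        + 2 * Complex.I * (2 - α0) * σ2 t := by
  set s := 3 - α0 with hs_def
  have hα0 : α0 = 3 - s := by rw [hs_def]; ring
  have e1 : 1 - α0 = s - 2 := by rw [hs_def]; ring
  have e5 : 5 - α0 = s + 2 := by rw [hs_def]; ring
  have e7 : 7 - α0 = s + 4 := by rw [hs_def]; ring
  have hs : 2 < s := by rw [hs_def]; linarith
  rw [e1, e5] at hC1
  rw [e1, e5, e7] at hA
  rw [e5] at hB hω
  have hC : (s + 2) * C ^ 2 ≤ s - 2 := by
    have hsq : C ^ 2 ≤ (s - 2) / (s + 2) := by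
      have h0 : 0 ≤ (s - 2) / (s + 2) := div_nonneg (by linarith) (by linarith)
      rw [← Real.sq_sqrt h0]
      gcongr
    rw [le_div_iff₀ (by linarith)] at hsq
    linarith
  have hd : 0 < s - (s + 2) * C ^ 2 := by linarith
  have hD : 0 < s ^ 2 - (s + 2) ^ 2 * C ^ 2 := by nlinarith
  have hrad : 0 ≤ (s - (s + 4) * C ^ 2) * ((s - 2) - (s + 2) * C ^ 2) :=
    mul_nonneg (by nlinarith) (by linarith)
  have hA2 : (s ^ 2 - (s + 2) ^ 2 * C ^ 2) ^ 2 * A ^ 2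
      = s ^ 2 * ((s - (s + 4) * C ^ 2) * ((s - 2) - (s + 2) * C ^ 2)) := by
    rw [hA, div_pow, mul_pow, Real.sq_sqrt hrad]
    field_simp
  have hs0 : (s : ℂ) ≠ 0 := by exact_mod_cast (by linarith : s ≠ 0)
  have hd' : (s : ℂ) - (s + 2) * C ^ 2 ≠ 0 := by exact_mod_cast hd.ne'
  have hA2' : ((s : ℂ) ^ 2 - (s + 2) ^ 2 * C ^ 2) ^ 2 * A ^ 2
      = s ^ 2 * ((s - (s + 4) * C ^ 2) * ((s - 2) - (s + 2) * C ^ 2)) := by exact_mod_cast hA2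
  have hB' : (B : ℂ) = (s + 2) * A * C / s := by rw [hB]; push_cast; ring
  have hω' : (ω : ℂ) = ((s : ℂ) ^ 2 - (s + 2) ^ 2 * C ^ 2) / (s - (s + 2) * C ^ 2) := by
    rw [hω]; push_cast; ring
  have hα' : (α0 : ℂ) = 3 - s := by rw [hα0]; push_cast; ring
  intro t
  have hexp : HasDerivAt (fun t : ℝ => Complex.exp (Complex.I * ω * t))
      (Complex.exp (Complex.I * ω * t) * (Complex.I * ω)) t := by
    have h := ((Complex.ofRealCLM.hasDerivAt (x := t)).const_mul (Complex.I * ω)).cexp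
    simpa using h
  have hder1 : deriv σ1 t = B * (Complex.exp (Complex.I * ω * t) * (Complex.I * ω)) := by
    rw [funext hσ1]
    exact ((hexp.const_mul (B : ℂ)).const_add (-(A : ℂ))).deriv
  have hder2 : deriv σ2 t = -C * (Complex.exp (Complex.I * ω * t) * (Complex.I * ω)) := by
    rw [funext hσ2]
    exact (hexp.const_mul (-(C : ℂ))).deriv
  rw [hder1, hder2, hσ1 t, hσ2 t]
  have hphase : Complex.I * ω * t = ((ω * t : ℝ) : ℂ) * Complex.I := by push_cast; ring
  have hE0 : Complex.exp (Complex.I * ω * t) ≠ 0 := Complex.exp_ne_zero _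
  have hconj : (starRingEnd ℂ) (Complex.exp (Complex.I * ω * t))
      = (Complex.exp (Complex.I * ω * t))⁻¹ := by
    rw [hphase, ← Complex.exp_neg, ← Complex.exp_conj]
    simp
  have hcos : Complex.exp (Complex.I * ω * t) + (Complex.exp (Complex.I * ω * t))⁻¹
      = 2 * (Real.cos (ω * t) : ℂ) := by
    rw [hphase, ← Complex.exp_neg, Complex.ofReal_cos, Complex.two_cos, neg_mul]
  generalize Complex.exp (Complex.I * ω * t) = E at *
  have hQ : (s : ℂ) ^ 2 * Qf (-(A : ℂ) + B * E) (-(C : ℂ) * E)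
      = ((s ^ 2 * (1 - C ^ 2) ^ 2 - A ^ 2 * ((s ^ 2 + (s + 2) ^ 2 * C ^ 2) * (1 + C ^ 2)
        - 4 * s * (s + 2) * C ^ 2
        - 4 * Real.cos (ω * t) * C * (s - (s + 2) * C ^ 2)) : ℝ) : ℂ) := by
    have hc : (Real.cos (ω * t) : ℂ) = (E + E⁻¹) / 2 := by rw [hcos]; ring
    simp only [Complex.ofReal_sub, Complex.ofReal_add, Complex.ofReal_mul, Complex.ofReal_pow,
      Complex.ofReal_one, Complex.ofReal_ofNat]
    rw [hc]
    simp only [Qf, Complex.normSq_eq_conj_mul_self]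
    simp only [map_add, map_mul, map_neg, Complex.conj_ofReal, hconj]
    simp only [hB']
    field_simp
    ring
  have hQ0 : Qf (-(A : ℂ) + B * E) (-(C : ℂ) * E) ≠ 0 := by
    intro h
    rw [h, mul_zero] at hQ
    exact (denominator_pos_of_amplitude_relation hs hC0 hC hA2
      (Real.neg_one_le_cos (ω * t)) (Real.cos_le_one (ω * t))).ne (by exact_mod_cast hQ)
  have h1 : ω * B * E * Qf (-(A : ℂ) + B * E) (-(C : ℂ) * E)
      = -2 * P1 (-(A : ℂ) + B * E) (-(C : ℂ) * E)
        + (s - 2) * (-(A : ℂ) + B * E) * Qf (-(A : ℂ) + B * E) (-(C : ℂ) * E) := by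
    simp only [P1, Qf, Complex.normSq_eq_conj_mul_self]
    simp only [map_add, map_mul, map_neg, Complex.conj_ofReal, hconj]
    simp only [hB', hω']
    linear_combination (norm := (field_simp; ring))
      (A * (-1 / s ^ 3 + 2 * C * E / (s ^ 3 * (s - (s + 2) * C ^ 2))) : ℂ) * hA2'
  have h2 : ω * Qf (-(A : ℂ) + B * E) (-(C : ℂ) * E)
      = -2 * P2 (-(A : ℂ) + B * E) (-(C : ℂ) * E)
        + 2 * (s - 1) * Qf (-(A : ℂ) + B * E) (-(C : ℂ) * E) := by
    simp only [P2, Qf, Complex.normSq_eq_conj_mul_self]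
    simp only [map_add, map_mul, map_neg, Complex.conj_ofReal, hconj]
    simp only [hB', hω']
    linear_combination (norm := (field_simp; ring))
      ((1 - C ^ 2) / ((s - (s + 2) * C ^ 2) * s ^ 2) : ℂ) * hA2'
  refine ⟨hQ0, ?_, ?_⟩
  · rw [hα']
    generalize Qf (-(A : ℂ) + B * E) (-(C : ℂ) * E) = q at *
    generalize P1 (-(A : ℂ) + B * E) (-(C : ℂ) * E) = p at *
    field_simp
    linear_combination h1
  · rw [hα']
    generalize Qf (-(A : ℂ) + B * E) (-(C : ℂ) * E) = q at *
    generalize P2 (-(A : ℂ) + B * E) (-(C : ℂ) * E) = p at *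
    field_simp
    linear_combination (-C : ℂ) * h2


end
end

section
/- Let N ≥ 1 and let b ∈ (−1,1) be real; take β = b in the definition of (û_k). Define the sequence (z_k)_{k∈ℤ} by z_0 = −4Nb/(1−b²)², z_k = 2|k| b^{|k|/N − 1} for k ≠ 0 with N | k, and z_k = 0 otherwise (the Fourier coefficients of the derivative ∂u_{N,b}/∂b of the stationary solution with respect to the parameter b). Then for every k ∈ ℤ the series Σ_{l∈ℤ} û_{k−l} z_l converges absolutely and k(|k| z_k − Σ_{l∈ℤ} û_{k−l} z_l) = 0; that is, ∂u_{N,b}/∂b lies in the kernel of the linearized Benjamin–Ono operator BA. -/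
open Complex

noncomputable section

/-- Fourier coefficients of the `N`-hump stationary solution `u_{N,β}` of the
Benjamin–Ono equation: `û_0 = N α(β)` with `α(β) = (1-3|β|²)/(1-|β|²)`,
`û_k = 2N β^{k/N}` for `k > 0`, `N ∣ k`, `û_k = 2N conj(β)^{|k|/N}` for `k < 0`, `N ∣ k`,
and `û_k = 0` otherwise. -/
noncomputable def uhat (N : ℕ) (β : ℂ) : ℤ → ℂ := fun k =>
  if k = 0 then
    (N : ℂ) * (((1 - 3 * Complex.normSq β) / (1 - Complex.normSq β) : ℝ) : ℂ)
  else if (N : ℤ) ∣ k then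
    if 0 < k then 2 * (N : ℂ) * β ^ (k / (N : ℤ)).toNat
    else 2 * (N : ℂ) * ((starRingEnd ℂ) β) ^ ((-k) / (N : ℤ)).toNat
  else 0

open Finset in
/-- The convolution over `ℤ` of `j ↦ |j| x ^ (|j| - 1)` with `j ↦ x ^ |j|`, at a natural number. -/
theorem hasSum_natAbs_mul_pow_conv {x : ℂ} (hx : ‖x‖ < 1) (m : ℕ) :
    HasSum (fun j : ℤ => (j.natAbs : ℂ) * x ^ (j.natAbs - 1) * x ^ ((m : ℤ) - j).natAbs)
      (m * (m + 1) / 2 * x ^ (m - 1) + m * x ^ (m + 1) / (1 - x ^ 2)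
        + 2 * x ^ (m + 1) / (1 - x ^ 2) ^ 2) := by
  have hx2 : ‖x ^ 2‖ < 1 := by
    rw [norm_pow]
    exact pow_lt_one₀ (norm_nonneg _) hx two_ne_zero
  have hne : 1 - x ^ 2 ≠ 0 := fun h => by
    rw [← sub_eq_zero.mp h] at hx2
    simp at hx2
  have hgeo : HasSum (fun n : ℕ => (x ^ 2) ^ n) (1 - x ^ 2)⁻¹ := hasSum_geometric_of_norm_lt_one hx2
  have hcoe := hasSum_coe_mul_geometric_of_norm_lt_one hx2
  have hneg : HasSum (fun n : ℕ => ((n : ℂ) + 1) * x ^ (m + 1) * (x ^ 2) ^ n)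
      (x ^ (m + 1) * (x ^ 2 / (1 - x ^ 2) ^ 2) + x ^ (m + 1) * (1 - x ^ 2)⁻¹) := by
    refine ((hcoe.mul_left (x ^ (m + 1))).add (hgeo.mul_left (x ^ (m + 1)))).congr_fun fun n => ?_
    ring
  have htail : HasSum (fun n : ℕ => ((n : ℂ) + 1 + m) * x ^ (m + 1) * (x ^ 2) ^ n)
      (x ^ (m + 1) * (x ^ 2 / (1 - x ^ 2) ^ 2) + x ^ (m + 1) * (1 - x ^ 2)⁻¹
        + m * x ^ (m + 1) * (1 - x ^ 2)⁻¹) := by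
    refine (hneg.add (hgeo.mul_left (m * x ^ (m + 1)))).congr_fun fun n => ?_
    ring
  have hhead : ∑ i ∈ range (m + 1), (i : ℂ) * x ^ (i - 1) * x ^ ((m : ℤ) - i).natAbs
      = m * (m + 1) / 2 * x ^ (m - 1) := by
    have hterm : ∀ i ∈ range (m + 1), (i : ℂ) * x ^ (i - 1) * x ^ ((m : ℤ) - i).natAbs
        = i * x ^ (m - 1) := by
      intro i hi
      have him := mem_range.mp hi
      rcases Nat.eq_zero_or_pos i with rfl | hi0
      · simp
      · rw [mul_assoc, ← pow_add]
        congr 2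
        omega
    rw [sum_congr rfl hterm, ← sum_mul]
    congr 1
    have h := congrArg (Nat.cast : ℕ → ℂ) (sum_range_id_mul_two (m + 1))
    push_cast [Nat.add_sub_cancel] at h
    linear_combination h / 2
  have hpos : HasSum
      (fun n : ℕ => ((n : ℤ).natAbs : ℂ) * x ^ ((n : ℤ).natAbs - 1) * x ^ ((m : ℤ) - n).natAbs)
      (x ^ (m + 1) * (x ^ 2 / (1 - x ^ 2) ^ 2) + x ^ (m + 1) * (1 - x ^ 2)⁻¹
        + m * x ^ (m + 1) * (1 - x ^ 2)⁻¹ + m * (m + 1) / 2 * x ^ (m - 1)) := by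
    simp only [Int.natAbs_natCast]
    rw [← hhead, ← hasSum_nat_add_iff (m + 1)]
    refine htail.congr_fun fun n => ?_
    rw [mul_assoc, ← pow_add, ← pow_mul, mul_assoc, ← pow_add]
    congr 1
    · push_cast
      ring
    · congr 1
      omega
  have key := HasSum.of_nat_of_neg_add_one hpos
    (f := fun j : ℤ => (j.natAbs : ℂ) * x ^ (j.natAbs - 1) * x ^ ((m : ℤ) - j).natAbs)
    (by
      refine hneg.congr_fun fun n => ?_
      rw [mul_assoc, ← pow_add, ← pow_mul, mul_assoc, ← pow_add]
      have h : (-((n : ℤ) + 1)).natAbs = n + 1 := by omega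
      rw [h]
      congr 1
      · push_cast
        ring
      · congr 1
        omega)
  convert key using 1
  field_simp
  ring

theorem uhat_ofReal_mul {N : ℕ} (hN : 1 ≤ N) {b : ℝ} (hb : 1 - b ^ 2 ≠ 0) (n : ℤ) :
    uhat N (b : ℂ) (N * n) = 2 * N * (b : ℂ) ^ n.natAbs
      - if n = 0 then (N : ℂ) * ((1 + (b : ℂ) ^ 2) / (1 - (b : ℂ) ^ 2)) else 0 := by
  have hN0 : (N : ℤ) ≠ 0 := by omega
  have hNpos : (0 : ℤ) < N := by omega
  rcases lt_trichotomy n 0 with hn | rfl | hn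
  · have h1 : ¬ (0 < (N : ℤ) * n) := by nlinarith
    have h2 : (-n).toNat = n.natAbs := by omega
    rw [uhat, if_neg (mul_ne_zero hN0 hn.ne), if_pos (dvd_mul_right _ _), if_neg h1, ← mul_neg,
      Int.mul_ediv_cancel_left _ hN0, h2, if_neg hn.ne, Complex.conj_ofReal, sub_zero]
  · have hb' : 1 - (b : ℂ) ^ 2 ≠ 0 := by exact_mod_cast hb
    simp only [uhat, mul_zero, if_true, Complex.normSq_ofReal, Int.natAbs_zero, pow_zero]
    push_cast
    rw [← pow_two]
    field_simp
    ring
  · have h1 : 0 < (N : ℤ) * n := by positivity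
    have h2 : n.toNat = n.natAbs := by omega
    rw [uhat, if_neg (mul_ne_zero hN0 hn.ne'), if_pos (dvd_mul_right _ _), if_pos h1,
      Int.mul_ediv_cancel_left _ hN0, h2, if_neg hn.ne', sub_zero]

theorem uhat_ofReal_neg (N : ℕ) (b : ℝ) (k : ℤ) : uhat N (b : ℂ) (-k) = uhat N (b : ℂ) k := by
  rcases lt_trichotomy k 0 with hk | rfl | hk
  · simp [uhat, hk.ne, hk, hk.not_gt]
  · simp
  · simp [uhat, hk.ne', hk, hk.not_gt]

theorem uhat_eq_zero_of_not_dvd {N : ℕ} {k : ℤ} (β : ℂ) (hk : ¬ (N : ℤ) ∣ k) : uhat N β k = 0 := by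
  have : k ≠ 0 := fun h => hk (h ▸ dvd_zero _)
  simp [uhat, this, hk]

theorem dudb_in_kernel_of_BA
    (N : ℕ) (hN : 1 ≤ N) (b : ℝ) (hb1 : -1 < b) (hb2 : b < 1)
    (z : ℤ → ℂ)
    (hz : ∀ k : ℤ, z k =
      if k = 0 then ((-4 * (N : ℝ) * b / (1 - b^2)^2 : ℝ) : ℂ)
      else if (N : ℤ) ∣ k then
        2 * ((|k| : ℤ) : ℂ) * ((b : ℂ)) ^ ((|k| / (N : ℤ)) - 1).toNat
      else 0) :
    ∀ k : ℤ,
      Summable (fun l : ℤ => ‖uhat N (b : ℂ) (k - l) * z l‖) ∧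
      (k : ℂ) * (((|k| : ℤ) : ℂ) * z k - ∑' l : ℤ, uhat N (b : ℂ) (k - l) * z l) = 0 := by
  have hb : 1 - b ^ 2 ≠ 0 := by nlinarith
  have hbC : 1 - (b : ℂ) ^ 2 ≠ 0 := by exact_mod_cast hb
  have hnorm : ‖(b : ℂ)‖ < 1 := by
    rw [Complex.norm_real, Real.norm_eq_abs, abs_lt]
    exact ⟨hb1, hb2⟩
  have hNz : (N : ℤ) ≠ 0 := by omega
  have hz_not : ∀ k : ℤ, ¬ (N : ℤ) ∣ k → z k = 0 := fun k hk => by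
    have : k ≠ 0 := fun h => hk (h ▸ dvd_zero _)
    rw [hz, if_neg this, if_neg hk]
  have hz_neg : ∀ k : ℤ, z (-k) = z k := fun k => by simp [hz]
  have hz_mul : ∀ j : ℤ, z (N * j) = 2 * N * (j.natAbs * (b : ℂ) ^ (j.natAbs - 1))
      + if j = 0 then z 0 else 0 := by
    intro j
    rcases eq_or_ne j 0 with rfl | hj
    · simp
    · have h1 : |(N : ℤ) * j| = N * |j| := by rw [abs_mul, Nat.abs_cast]
      have h2 : (|j| - 1).toNat = j.natAbs - 1 := by
        rw [Int.abs_eq_natAbs]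
        omega
      rw [hz, if_neg (mul_ne_zero hNz hj), if_pos (dvd_mul_right _ _), h1,
        Int.mul_ediv_cancel_left _ hNz, h2, if_neg hj, Nat.cast_natAbs]
      push_cast
      ring
  have hmain : ∀ m : ℕ, ∃ S : ℂ,
      HasSum (fun l : ℤ => uhat N (b : ℂ) (N * m - l) * z l) S ∧
        (m ≠ 0 → S = N * m * z (N * m)) := by
    intro m
    have hconv := (hasSum_natAbs_mul_pow_conv hnorm m).mul_left (4 * (N : ℂ) ^ 2)
    have hzero := hasSum_ite_eq (0 : ℤ) (uhat N (b : ℂ) (N * m) * z 0)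
    have hdiag := hasSum_ite_eq (m : ℤ) ((N : ℂ) * ((1 + (b : ℂ) ^ 2) / (1 - (b : ℂ) ^ 2))
      * (2 * N * (m * (b : ℂ) ^ (m - 1))))
    refine ⟨_, ((mul_right_injective₀ hNz).hasSum_iff ?_).mp
      (((hconv.add hzero).sub hdiag).congr_fun fun j => ?_), ?_⟩
    · intro l hl
      rw [hz_not l (fun ⟨c, hc⟩ => hl ⟨c, hc.symm⟩), mul_zero]
    · simp only [Function.comp_apply]
      rw [← mul_sub, uhat_ofReal_mul hN hb, hz_mul]
      rcases eq_or_ne j 0 with rfl | hj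
      · rw [uhat_ofReal_mul hN hb]
        rcases eq_or_ne m 0 with rfl | hm
        · simp
        · have h : (0 : ℤ) ≠ m := by omega
          simp [hm, h]
      · rcases eq_or_ne j m with rfl | hjm
        · simp only [hj, if_false, sub_self, if_true, Int.natAbs_natCast, Int.natAbs_zero]
          ring
        · have h : (m : ℤ) - j ≠ 0 := fun h => hjm (by omega)
          simp only [hj, hjm, h, if_false]
          ring
    · intro hm
      obtain ⟨n, rfl⟩ := Nat.exists_eq_succ_of_ne_zero hm
      rw [uhat_ofReal_mul hN hb, hz_mul, hz 0]
      simp only [Nat.succ_eq_add_one, Int.natAbs_natCast, Nat.cast_eq_zero, hm, if_false, if_true,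
        Nat.add_sub_cancel]
      push_cast
      field_simp
      ring
  have hsigned : ∀ m : ℕ, ∀ s : ℤ, s = N * m ∨ s = -(N * m) → ∃ S : ℂ,
      HasSum (fun l : ℤ => uhat N (b : ℂ) (s - l) * z l) S ∧ (s ≠ 0 → S = (|s| : ℤ) * z s) := by
    rintro m s hs
    obtain ⟨S, hS, hSm⟩ := hmain m
    have habs : |s| = N * m := by
      have : |(N : ℤ) * m| = N * m := abs_of_nonneg (by positivity)
      rcases hs with rfl | rfl
      · exact this
      · rw [abs_neg, this]
    have hzs : z s = z (N * m) := by
      rcases hs with rfl | rfl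
      · rfl
      · exact hz_neg _
    refine ⟨S, ?_, fun h => ?_⟩
    · rcases hs with rfl | rfl
      · exact hS
      · rw [← (Equiv.neg ℤ).hasSum_iff]
        convert hS using 2 with l
        simp only [Function.comp_apply, Equiv.neg_apply]
        rw [hz_neg, ← uhat_ofReal_neg]
        congr 2
        ring
    · rw [habs, hzs, hSm (fun h0 => h (by rcases hs with rfl | rfl <;> simp [h0]))]
      push_cast
      rfl
  intro k
  rw [summable_norm_iff]
  by_cases hk : (N : ℤ) ∣ k
  · obtain ⟨c, rfl⟩ := hk
    obtain ⟨S, hS, hSk⟩ := hsigned c.natAbs (N * c) (by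
      rcases Int.natAbs_eq c with h | h
      · left
        rw [← h]
      · right
        rw [← mul_neg, ← h])
    refine ⟨hS.summable, ?_⟩
    rw [hS.tsum_eq]
    rcases eq_or_ne ((N : ℤ) * c) 0 with h0 | h0
    · rw [h0]
      simp
    · rw [hSk h0, sub_self, mul_zero]
  · have hzero : (fun l : ℤ => uhat N (b : ℂ) (k - l) * z l) = fun _ => 0 := by
      funext l
      by_cases hl : (N : ℤ) ∣ l
      · rw [uhat_eq_zero_of_not_dvd _ (fun h => hk ((dvd_sub_left hl).mp h)), zero_mul]
      · rw [hz_not l hl, mul_zero]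
    rw [hzero, hz_not k hk]
    simp [summable_zero]

end
end
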